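/- For every finitely generated group G there exists a finitely generated group H with G ≤ H ≤ Sym(G × ℤ) (where G × ℤ is embedded in Sym(G × ℤ) via left translations, and G ≤ G × ℤ is the first factor) such that: (1) there is a locally finite normal subgroup N of H with H/N isomorphic to G × ℤ; (2) the natural action of H on the set G × ℤ is faithful and k-transitive for every k ∈ ℕ; (3) H is mixed identity free. -/

import Mathlib

/-- A group is locally finite if each of its finitely generated subgroups is finite. -/
def IsLocallyFinite (N : Type*) [Group N] : Prop :=
  ∀ K : Subgroup N, K.FG → Finite K

/-- A group `H` is mixed identity free if for every nontrivial element `w` of the free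
product `H ∗ ℤ` there is a homomorphism `φ : H ∗ ℤ → H` restricting to the identity on `H`
with `φ w ≠ 1`. -/
def MixedIdentityFree (H : Type*) [Group H] : Prop :=
  ∀ w : Monoid.Coprod H (Multiplicative ℤ), w ≠ 1 →
    ∃ φ : Monoid.Coprod H (Multiplicative ℤ) →* H,
      (∀ h : H, φ (Monoid.Coprod.inl h) = h) ∧ φ w ≠ 1

/-- The action of a group `H` on `Ω` via `ρ : H →* Equiv.Perm Ω` is `k`-transitive:
`Ω` has at least `k` points, and any `k`-tuple of pairwise distinct points can be carried
to any other. -/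
def IsKTransitive {H : Type*} [Group H] {Ω : Type*} (ρ : H →* Equiv.Perm Ω) (k : ℕ) :
    Prop :=
  Nonempty (Fin k ↪ Ω) ∧ ∀ x y : Fin k ↪ Ω, ∃ h : H, ∀ i : Fin k, ρ h (x i) = y i

/-- A finitely generated group has finitely many homomorphisms to a finite group. -/
theorem finite_monoidHom_of_fg (K M : Type*) [Group K] [Group.FG K] [Group M] [Finite M] :
    Finite (K →* M) := by
  obtain ⟨S, hS⟩ := (Group.fg_def.1 ‹Group.FG K›)
  refine Finite.of_injective (fun (f : K →* M) (s : S) => f s) fun f g hfg => ?_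
  exact MonoidHom.eq_of_eqOn_dense hS fun s hs => congrFun hfg ⟨s, hs⟩

/-- A finitely generated permutation group is finite as soon as some map to a finite set
is injective on each orbit. -/
theorem finite_of_fg_of_orbit_separating {Ω Q : Type*} [Finite Q]
    (K : Subgroup (Equiv.Perm Ω)) (hK : K.FG) (κ : Ω → Q)
    (hκ : ∀ h ∈ K, ∀ p, κ (h p) = κ p → h p = p) : Finite K := by
  have : Group.FG K := (Group.fg_iff_subgroup_fg K).2 hK
  have := finite_monoidHom_of_fg K (Equiv.Perm Q)
  have hinj (p : Ω) : Function.Injective fun q : MulAction.orbit K p => κ q := by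
    rintro ⟨_, a, rfl⟩ ⟨_, b, rfl⟩ h
    have := hκ (a * b⁻¹ : K) (a * b⁻¹ : K).2 (b • p) (by simpa [Subgroup.smul_def] using h)
    simpa [Subgroup.smul_def] using this
  let ψ (p : Ω) : K →* Equiv.Perm Q :=
    (Equiv.Perm.viaEmbeddingHom ⟨_, hinj p⟩).comp (MulAction.toPermHom K (MulAction.orbit K p))
  have hψ (p : Ω) (k : K) (hk : ψ p k = 1) : (k : Equiv.Perm Ω) p = p := by
    have h1 : MulAction.toPermHom K (MulAction.orbit K p) k = 1 :=
      Equiv.Perm.viaEmbeddingHom_injective ⟨_, hinj p⟩ (by rw [map_one]; exact hk)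
    have h2 := congrArg Subtype.val
      (Equiv.congr_fun h1 ⟨p, MulAction.mem_orbit_self p⟩)
    simpa [Subgroup.smul_def] using h2
  let Φ : K →* ((K →* Equiv.Perm Q) → Equiv.Perm Q) := MonoidHom.pi fun f => f
  refine Finite.of_injective Φ ((injective_iff_map_eq_one Φ).2 fun k hk => ?_)
  exact Subtype.ext (Equiv.ext fun p => hψ p k (congrFun hk (ψ p)))

/-- The closure of `H` for the topology of pointwise convergence on `Ω`. -/
def pointwiseClosure {Ω : Type*} (H : Subgroup (Equiv.Perm Ω)) : Subgroup (Equiv.Perm Ω) where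
  carrier := {σ | ∀ A : Set Ω, A.Finite → ∃ h ∈ H, ∀ a ∈ A, h a = σ a}
  one_mem' _ _ := ⟨1, H.one_mem, fun _ _ => rfl⟩
  mul_mem' {σ τ} hσ hτ A hA := by
    obtain ⟨k, hk, hkA⟩ := hτ A hA
    obtain ⟨h, hh, hhA⟩ := hσ (τ '' A) (hA.image _)
    refine ⟨h * k, H.mul_mem hh hk, fun a ha => ?_⟩
    rw [Equiv.Perm.mul_apply, hkA a ha, hhA _ ⟨a, ha, rfl⟩, Equiv.Perm.mul_apply]
  inv_mem' {σ} hσ A hA := by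
    obtain ⟨h, hh, hhA⟩ := hσ (σ.symm '' A) (hA.image _)
    refine ⟨h⁻¹, H.inv_mem hh, fun a ha => ?_⟩
    have := hhA _ ⟨a, ha, rfl⟩
    rw [Equiv.apply_symm_apply] at this
    exact Equiv.Perm.inv_eq_iff_eq.2 this.symm

theorem le_pointwiseClosure {Ω : Type*} (H : Subgroup (Equiv.Perm Ω)) :
    H ≤ pointwiseClosure H :=
  fun h hh _ _ => ⟨h, hh, fun _ _ => rfl⟩

/-- A permutation group on an infinite set is highly transitive if its pointwise closure contains
all transpositions. -/
theorem isKTransitive_of_swap_mem {Ω : Type*} [Infinite Ω] [DecidableEq Ω]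
    (H : Subgroup (Equiv.Perm Ω)) (hH : ∀ p q, Equiv.swap p q ∈ pointwiseClosure H) (k : ℕ) :
    IsKTransitive H.subtype k := by
  refine ⟨⟨Fin.valEmbedding.trans (Infinite.natEmbedding Ω)⟩, fun x y => ?_⟩
  have key (s : Finset (Fin k)) : ∃ σ ∈ pointwiseClosure H, ∀ i ∈ s, σ (x i) = y i := by
    induction s using Finset.induction with
    | empty => exact ⟨1, Subgroup.one_mem _, by simp⟩
    | insert a s ha ih =>
      obtain ⟨σ, hσ, hs⟩ := ih
      refine ⟨Equiv.swap (σ (x a)) (y a) * σ, Subgroup.mul_mem _ (hH _ _) hσ, fun i hi => ?_⟩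
      rcases Finset.mem_insert.1 hi with rfl | hi
      · simp
      · have hia : i ≠ a := fun h => ha (h ▸ hi)
        rw [Equiv.Perm.mul_apply, Equiv.swap_apply_of_ne_of_ne, hs i hi]
        · exact fun h => hia (x.injective (σ.injective h))
        · rw [hs i hi]
          exact fun h => hia (y.injective h)
  obtain ⟨σ, hσ, hxy⟩ := key Finset.univ
  obtain ⟨h, hh, hx⟩ := hσ (Set.range x) (Set.finite_range x)
  exact ⟨⟨h, hh⟩, fun i => (hx _ ⟨i, rfl⟩).trans (hxy i (Finset.mem_univ i))⟩

section MixedIdentity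

/-- The letter `x` or `x⁻¹`. -/
def signedLetter {H : Type*} [Group H] (x : H) (ε : Bool) : H := if ε then x else x⁻¹

theorem map_signedLetter {H K : Type*} [Group H] [Group K] (f : H →* K) (x : H) (ε : Bool) :
    f (signedLetter x ε) = signedLetter (f x) ε := by
  cases ε <;> simp [signedLetter]

theorem signedLetter_mul_signedLetter_not {H : Type*} [Group H] (x : H) (ε : Bool) :
    signedLetter x (!ε) * signedLetter x ε = 1 := by
  cases ε <;> simp [signedLetter]

/-- The value at `x` of the word `hₙ x^εₙ ⋯ h₁ x^ε₁` encoded by the list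
`[(ε₁, h₁), …, (εₙ, hₙ)]`, with coefficients mapped along `f`. -/
def wordValue {H K : Type*} [Group H] [Group K] (f : H →* K) (x : K) : List (Bool × H) → K
  | [] => 1
  | (ε, h) :: l => wordValue f x l * f h * signedLetter x ε

theorem map_wordValue {H K L : Type*} [Group H] [Group K] [Group L] (f : H →* K) (g : K →* L)
    (x : K) (l : List (Bool × H)) :
    g (wordValue f x l) = wordValue (g.comp f) (g x) l := by
  induction l with
  | nil => simp [wordValue]
  | cons a l ih => simp [wordValue, ih, map_signedLetter]

/-- The word encoded by a list has no subword `x⁻¹ 1 x` or `x 1 x⁻¹`. -/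
def IsReducedWord {H : Type*} [Group H] (l : List (Bool × H)) : Prop :=
  l.IsChain fun a b => a.2 = 1 → b.1 = a.1

theorem exists_isReducedWord {H : Type*} [Group H] (w : Monoid.Coprod H (Multiplicative ℤ)) :
    ∃ (l : List (Bool × H)) (h : H), IsReducedWord l ∧
      w = wordValue Monoid.Coprod.inl (Monoid.Coprod.inr (Multiplicative.ofAdd 1)) l *
        Monoid.Coprod.inl h := by
  set t : Monoid.Coprod H (Multiplicative ℤ) :=
    Monoid.Coprod.inr (Multiplicative.ofAdd 1) with ht
  let S : Set (Monoid.Coprod H (Multiplicative ℤ)) :=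
    Set.range (Monoid.Coprod.inl : H →* Monoid.Coprod H (Multiplicative ℤ)) ∪ {t}
  have hcl : Subgroup.closure S = ⊤ := by
    refine top_le_iff.1 (Monoid.Coprod.range_inl_sup_range_inr.ge.trans (sup_le ?_ ?_))
    · rintro _ ⟨h, rfl⟩
      exact Subgroup.mem_closure_of_mem (Or.inl ⟨h, rfl⟩)
    · rintro _ ⟨z, rfl⟩
      have hz : z = Multiplicative.ofAdd (1 : ℤ) ^ z.toAdd := by
        rw [← ofAdd_zsmul]; simp
      rw [hz, map_zpow]
      have htS : t ∈ S := Or.inr rfl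
      exact Subgroup.zpow_mem _ (Subgroup.mem_closure_of_mem htS) _
  have letter (ε : Bool) (v : Monoid.Coprod H (Multiplicative ℤ))
      (hv : ∃ (l : List (Bool × H)) (h : H), IsReducedWord l ∧
        v = wordValue Monoid.Coprod.inl t l * Monoid.Coprod.inl h) :
      ∃ (l : List (Bool × H)) (h : H), IsReducedWord l ∧
        v * signedLetter t ε = wordValue Monoid.Coprod.inl t l * Monoid.Coprod.inl h := by
    obtain ⟨l, h, hl, rfl⟩ := hv
    by_cases hred : IsReducedWord ((ε, h) :: l)
    · exact ⟨(ε, h) :: l, 1, hred, by simp [wordValue]⟩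
    · cases l with
      | nil => exact absurd (List.isChain_singleton _) hred
      | cons a l =>
        obtain ⟨δ, k⟩ := a
        simp only [IsReducedWord, List.isChain_cons_cons] at hred hl
        push Not at hred
        have h1 : h = 1 ∧ δ ≠ ε := by
          by_contra hc
          exact hred (fun h1 => by_contra fun h2 => hc ⟨h1, h2⟩) hl
        obtain ⟨rfl, hδ⟩ := h1
        obtain rfl : δ = !ε := by cases δ <;> cases ε <;> simp_all
        refine ⟨l, k, hl.tail, ?_⟩
        simp [wordValue, mul_assoc, signedLetter_mul_signedLetter_not]
  have hw : w ∈ Subgroup.closure S := hcl ▸ Subgroup.mem_top w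
  induction hw using Subgroup.closure_induction_right with
  | one => exact ⟨[], 1, List.isChain_nil, by simp [wordValue]⟩
  | mul_right v _ y hy ih =>
    rcases hy with ⟨k, rfl⟩ | rfl
    · obtain ⟨l, h, hl, rfl⟩ := ih
      exact ⟨l, h * k, hl, by simp [mul_assoc]⟩
    · exact letter true v ih
  | mul_inv_cancel v _ y hy ih =>
    rcases hy with ⟨k, rfl⟩ | rfl
    · obtain ⟨l, h, hl, rfl⟩ := ih
      exact ⟨l, h * k⁻¹, hl, by simp [mul_assoc]⟩
    · exact letter false v ih

variable {Ω : Type*} [DecidableEq Ω] {H : Subgroup (Equiv.Perm Ω)}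

theorem exists_modify (hH : ∀ p q, Equiv.swap p q ∈ pointwiseClosure H) (x : H) {A : Set Ω}
    (hA : A.Finite) {q r : Ω} (hq : q ∉ A) (hr : r ∉ (x : Equiv.Perm Ω) '' A) :
    ∃ y : H, (∀ a ∈ A, (y : Equiv.Perm Ω) a = (x : Equiv.Perm Ω) a) ∧
      (y : Equiv.Perm Ω) q = r := by
  have hmem : Equiv.swap ((x : Equiv.Perm Ω) q) r * (x : Equiv.Perm Ω) ∈ pointwiseClosure H :=
    Subgroup.mul_mem _ (hH _ _) (le_pointwiseClosure H x.2)
  obtain ⟨y, hy, hyA⟩ := hmem (insert q A) (hA.insert q)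
  refine ⟨⟨y, hy⟩, fun a ha => ?_, ?_⟩
  · refine (hyA a (Set.mem_insert_of_mem _ ha)).trans ?_
    rw [Equiv.Perm.mul_apply, Equiv.swap_apply_of_ne_of_ne]
    · exact fun h => hq ((x : Equiv.Perm Ω).injective h ▸ ha)
    · exact fun h => hr ⟨a, ha, h⟩
  · simpa using hyA q (Set.mem_insert _ _)

/-- The points at which a letter `x` or `x⁻¹` is already prescribed, when `x` is prescribed
on `A`. -/
def prescribedPoints (x : Equiv.Perm Ω) (A : Set Ω) (ε : Bool) : Set Ω := if ε then A else x '' A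

theorem exists_modify_signedLetter (hH : ∀ p q, Equiv.swap p q ∈ pointwiseClosure H) (x : H)
    {A : Set Ω} (hA : A.Finite) (ε : Bool) {q r : Ω} (hq : q ∉ prescribedPoints (x : Equiv.Perm Ω) A ε)
    (hr : r ∉ prescribedPoints (x : Equiv.Perm Ω) A !ε) :
    ∃ (y : H) (A' : Set Ω), A'.Finite ∧ A ⊆ A' ∧
      (∀ a ∈ A, (y : Equiv.Perm Ω) a = (x : Equiv.Perm Ω) a) ∧
      (∀ z : H, (∀ a ∈ A', (z : Equiv.Perm Ω) a = (y : Equiv.Perm Ω) a) →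
        ((signedLetter z ε : H) : Equiv.Perm Ω) q = r) ∧
      prescribedPoints (y : Equiv.Perm Ω) A' ε =
        insert q (prescribedPoints (x : Equiv.Perm Ω) A ε) ∧
      prescribedPoints (y : Equiv.Perm Ω) A' (!ε) =
        insert r (prescribedPoints (x : Equiv.Perm Ω) A !ε) := by
  cases ε
  · obtain ⟨y, hy, hyr⟩ := exists_modify hH x hA (q := r) (r := q) hr hq
    refine ⟨y, insert r A, hA.insert r, Set.subset_insert _ _, hy, fun z hz => ?_, ?_, ?_⟩
    · have := hz r (Set.mem_insert _ _)
      exact Equiv.Perm.inv_eq_iff_eq.2 (by rw [this, hyr])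
    · simp [prescribedPoints, Set.image_insert_eq, hyr, Set.image_congr hy]
    · simp [prescribedPoints]
  · obtain ⟨y, hy, hyq⟩ := exists_modify hH x hA hq hr
    refine ⟨y, insert q A, hA.insert q, Set.subset_insert _ _, hy, fun z hz => ?_, ?_, ?_⟩
    · simpa [signedLetter, hyq] using hz q (Set.mem_insert _ _)
    · simp [prescribedPoints]
    · simp [prescribedPoints, Set.image_insert_eq, hyq, Set.image_congr hy]

theorem exists_wordValue_notMem [Infinite Ω]
    (hH : ∀ p q, Equiv.swap p q ∈ pointwiseClosure H)
    (hinf : ∀ h : H, h ≠ 1 → {p | (h : Equiv.Perm Ω) p ≠ p}.Infinite) {B : Set Ω} (hB : B.Finite)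
    (l : List (Bool × H)) (ε : Bool) (h : H) (hl : IsReducedWord ((ε, h) :: l)) (x : H) (A : Set Ω)
    (hA : A.Finite) (q : Ω) (hq : q ∉ prescribedPoints (x : Equiv.Perm Ω) A ε) :
    ∃ y : H, (∀ a ∈ A, (y : Equiv.Perm Ω) a = (x : Equiv.Perm Ω) a) ∧
      ((wordValue (MonoidHom.id H) y ((ε, h) :: l) : H) : Equiv.Perm Ω) q ∉ B := by
  induction l generalizing ε h x A q with
  | nil => ?_
  | cons b l ih => ?_
  all_goals
    let C : Set Ω := A ∪ (x : Equiv.Perm Ω) '' A ∪ {q} ∪ B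
    have hC : C.Finite := ((hA.union (hA.image _)).union (Set.finite_singleton q)).union hB
    have hAC : A ⊆ C := fun a ha => Or.inl (Or.inl (Or.inl ha))
    have hxAC : (x : Equiv.Perm Ω) '' A ⊆ C := fun a ha => Or.inl (Or.inl (Or.inr ha))
    have hPC (δ : Bool) : prescribedPoints (x : Equiv.Perm Ω) A δ ⊆ C := by
      cases δ
      · exact hxAC
      · exact hAC
    have hS : {r | h ≠ 1 → (h : Equiv.Perm Ω) r ≠ r}.Infinite := by
      by_cases h1 : h = 1
      · simpa [h1] using Set.infinite_univ
      · simpa [h1] using hinf h h1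
    obtain ⟨r, hr, hrC⟩ := (hS.sdiff (hC.union (hC.preimage
      ((h : Equiv.Perm Ω).injective.injOn)))).nonempty
    have hr1 : r ∉ C := fun hc => hrC (Or.inl hc)
    have hr2 : (h : Equiv.Perm Ω) r ∉ C := fun hc => hrC (Or.inr hc)
    obtain ⟨y, A', hA', hAA', hyx, hyz, hP1, hP2⟩ :=
      exists_modify_signedLetter hH x hA ε hq (fun hc => hr1 (hPC _ hc))
  · refine ⟨y, hyx, ?_⟩
    have := hyz y (fun _ _ => rfl)
    simp only [wordValue, MonoidHom.id_apply, one_mul, Subgroup.coe_mul, Equiv.Perm.mul_apply, this]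
    exact fun hc => hr2 (Or.inr hc)
  · obtain ⟨δ, k⟩ := b
    simp only [IsReducedWord, List.isChain_cons_cons] at hl
    have hq' : (h : Equiv.Perm Ω) r ∉ prescribedPoints (y : Equiv.Perm Ω) A' δ := by
      by_cases hδ : δ = ε
      · rw [hδ, hP1]
        rintro (hc | hc)
        · exact hr2 (Or.inl (Or.inr hc))
        · exact hr2 (hPC _ hc)
      · have hh : h ≠ 1 := fun h1 => hδ (hl.1 h1)
        obtain rfl : δ = !ε := by cases δ <;> cases ε <;> simp_all
        rw [hP2]
        rintro (hc | hc)
        · exact hr hh hc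
        · exact hr2 (hPC _ hc)
    obtain ⟨z, hz, hzB⟩ := ih δ k hl.2 y A' hA' _ hq'
    refine ⟨z, fun a ha => (hz a (hAA' ha)).trans (hyx a ha), ?_⟩
    rw [wordValue, MonoidHom.id_apply, Subgroup.coe_mul, Equiv.Perm.mul_apply, hyz z hz,
      Subgroup.coe_mul, Equiv.Perm.mul_apply]
    exact hzB

/-- A highly transitive group whose nontrivial elements have infinite support is mixed identity
free. -/
theorem mixedIdentityFree_of_infinite_support [Infinite Ω]
    (hH : ∀ p q, Equiv.swap p q ∈ pointwiseClosure H)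
    (hinf : ∀ h : H, h ≠ 1 → {p | (h : Equiv.Perm Ω) p ≠ p}.Infinite) :
    MixedIdentityFree H := by
  intro w hw
  obtain ⟨l, h, hl, rfl⟩ := exists_isReducedWord w
  have hφ (x : H) : ∃ φ : Monoid.Coprod H (Multiplicative ℤ) →* H,
      (∀ h : H, φ (Monoid.Coprod.inl h) = h) ∧
        φ (wordValue Monoid.Coprod.inl (Monoid.Coprod.inr (Multiplicative.ofAdd 1)) l *
          Monoid.Coprod.inl h) = wordValue (MonoidHom.id H) x l * h := by
    refine ⟨Monoid.Coprod.lift (MonoidHom.id H) (zpowersHom H x), by simp, ?_⟩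
    rw [map_mul, map_wordValue]
    simp
  cases l with
  | nil =>
    obtain ⟨φ, h1, h2⟩ := hφ 1
    refine ⟨φ, h1, fun hc => hw ?_⟩
    rw [hc] at h2
    simp only [wordValue, one_mul] at h2 ⊢
    rw [← h2, map_one]
  | cons a l =>
    let p : Ω := Classical.arbitrary Ω
    obtain ⟨x, -, hx⟩ := exists_wordValue_notMem hH hinf (Set.finite_singleton p) l a.1 a.2 hl 1 ∅
      Set.finite_empty ((h : Equiv.Perm Ω) p) (by simp [prescribedPoints])
    obtain ⟨φ, h1, h2⟩ := hφ x
    refine ⟨φ, h1, fun hc => hx ?_⟩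
    rw [hc] at h2
    have := congrArg (fun g : H => (g : Equiv.Perm Ω) p) h2
    simpa using this.symm

end MixedIdentity

/-- Finite approximations to `markedSet`. -/
def markedLevel : ℕ → Set ℤ
  | 0 => ∅
  | j + 1 => {m | m ∈ markedLevel j ∨ m - 4 ^ (j + 1) ∈ markedLevel j ∨ m = 2 * 4 ^ (j + 1)}

/-- A set of integers each of whose finite patterns recurs, which has arbitrarily isolated points,
and which avoids arbitrarily long intervals occurring periodically. -/
def markedSet : Set ℤ := ⋃ j, markedLevel j

theorem markedLevel_mono : Monotone markedLevel :=
  monotone_nat_of_le_succ fun _ _ hm => Or.inl hm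

theorem mem_Icc_of_mem_markedLevel {j : ℕ} {m : ℤ} (hm : m ∈ markedLevel j) :
    0 ≤ m ∧ m ≤ 2 * 4 ^ j := by
  induction j generalizing m with
  | zero => exact hm.elim
  | succ j ih =>
    have h4 : (0 : ℤ) < 4 ^ j := by positivity
    rw [pow_succ]
    rcases hm with hm | hm | rfl
    · have := ih hm
      omega
    · have := ih hm
      rw [pow_succ] at this
      omega
    · rw [pow_succ]
      omega

theorem nonneg_of_mem_markedSet {m : ℤ} (hm : m ∈ markedSet) : 0 ≤ m := by
  obtain ⟨j, hj⟩ := Set.mem_iUnion.1 hm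
  exact (mem_Icc_of_mem_markedLevel hj).1

theorem mem_markedLevel_of_lt {j : ℕ} {m : ℤ} (hm : m ∈ markedSet) (hlt : m < 4 ^ (j + 1)) :
    m ∈ markedLevel j := by
  obtain ⟨i, hi⟩ := Set.mem_iUnion.1 hm
  induction i with
  | zero => exact hi.elim
  | succ i ih =>
    rcases le_or_gt (i + 1) j with hij | hij
    · exact markedLevel_mono hij hi
    · have h4 : (4 : ℤ) ^ (j + 1) ≤ 4 ^ (i + 1) := pow_le_pow_right₀ (by norm_num) hij
      rcases hi with hi | hi | rfl
      · exact ih hi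
      · have := (mem_Icc_of_mem_markedLevel hi).1
        omega
      · have : (0 : ℤ) < 4 ^ (j + 1) := by positivity
        omega

theorem emod_le_of_mem_markedSet (j : ℕ) {m : ℤ} (hm : m ∈ markedSet) :
    m % 4 ^ (j + 1) ≤ 2 * 4 ^ j := by
  obtain ⟨i, hi⟩ := Set.mem_iUnion.1 hm
  clear hm
  induction i generalizing m with
  | zero => exact hi.elim
  | succ i ih =>
    have h4 : (0 : ℤ) < 4 ^ j := by positivity
    rcases le_or_gt (i + 1) j with hij | hij
    · have := mem_Icc_of_mem_markedLevel (markedLevel_mono hij hi)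
      rw [Int.emod_eq_of_lt this.1 (by rw [pow_succ]; omega)]
      exact this.2
    · obtain ⟨c, hc⟩ : (4 : ℤ) ^ (j + 1) ∣ 4 ^ (i + 1) := pow_dvd_pow 4 hij
      rcases hi with hi | hi | rfl
      · exact ih hi
      · have := ih hi
        rwa [hc, Int.sub_mul_emod_self_left] at this
      · rw [hc, mul_left_comm, Int.mul_emod_right]
        positivity

theorem four_dvd_of_mem_markedSet {m : ℤ} (hm : m ∈ markedSet) : 4 ∣ m := by
  obtain ⟨i, hi⟩ := Set.mem_iUnion.1 hm
  clear hm
  induction i generalizing m with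
  | zero => exact hi.elim
  | succ i ih =>
    rcases hi with hi | hi | rfl
    · exact ih hi
    · have := ih hi
      rw [pow_succ] at this
      omega
    · rw [pow_succ]
      omega

theorem add_one_notMem_markedSet {m : ℤ} (hm : m ∈ markedSet) : m + 1 ∉ markedSet := fun h => by
  have := four_dvd_of_mem_markedSet hm
  have := four_dvd_of_mem_markedSet h
  omega

theorem exists_lt_four_pow (n : ℤ) : ∃ J : ℕ, ∀ j ≥ J, n < 4 ^ j := by
  obtain ⟨J, hJ⟩ := pow_unbounded_of_one_lt n (by norm_num : (1 : ℤ) < 4)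
  exact ⟨J, fun j hj => hJ.trans_le (pow_le_pow_right₀ (by norm_num) hj)⟩

/-- Every finite pattern of `markedSet` recurs. -/
theorem eventually_add_mem_markedSet_iff (m : ℤ) :
    ∀ᶠ i : ℕ in Filter.atTop, m + 4 ^ (i + 1) ∈ markedSet ↔ m ∈ markedSet := by
  obtain ⟨J, hJ⟩ := exists_lt_four_pow |m|
  filter_upwards [Filter.eventually_ge_atTop J] with i hi
  have hm := abs_lt.1 (hJ i hi)
  have h1 : (4 : ℤ) ^ (i + 1) = 4 ^ i * 4 := pow_succ 4 i
  have h2 : (4 : ℤ) ^ (i + 1 + 1) = 4 ^ i * 16 := by ring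
  constructor
  · intro h
    rcases mem_markedLevel_of_lt (j := i + 1) h (by omega) with h | h | h
    · have := mem_Icc_of_mem_markedLevel h
      omega
    · rw [add_sub_cancel_right] at h
      exact Set.mem_iUnion.2 ⟨i, h⟩
    · omega
  · intro h
    refine Set.mem_iUnion.2 ⟨i + 1, Or.inr (Or.inl ?_)⟩
    rw [add_sub_cancel_right]
    exact mem_markedLevel_of_lt h (by omega)

/-- The set `markedSet` has arbitrarily isolated points. -/
theorem exists_isolated_mem_markedSet (n : ℤ) :
    ∃ x ∈ markedSet, ∀ y ∈ markedSet, |y - x| ≤ n → y = x := by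
  obtain ⟨i, hi⟩ := exists_lt_four_pow n
  have hi := hi i le_rfl
  have h1 : (4 : ℤ) ^ (i + 1) = 4 ^ i * 4 := pow_succ 4 i
  have h2 : (4 : ℤ) ^ (i + 1 + 1) = 4 ^ i * 16 := by ring
  refine ⟨2 * 4 ^ (i + 1), Set.mem_iUnion.2 ⟨i + 1, Or.inr (Or.inr rfl)⟩, fun y hy hyn => ?_⟩
  have hyn := abs_le.1 hyn
  rcases mem_markedLevel_of_lt (j := i + 1) hy (by omega) with h | h | h
  · have := mem_Icc_of_mem_markedLevel h
    omega
  · have := mem_Icc_of_mem_markedLevel h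
    omega
  · exact h

/-- The index of the interval of length `4 ^ (j + 1)` containing `m`; the endpoints of these
intervals are far from `markedSet`. -/
def blockIndex (j : ℕ) (m : ℤ) : ℤ := (m + 4 ^ j) / 4 ^ (j + 1)

theorem exists_blockIndex_add_one_eq (d : ℤ) :
    ∃ J : ℕ, ∀ j ≥ J, ∀ x ∈ markedSet, blockIndex j (x + 1 + d) = blockIndex j (x + d) := by
  obtain ⟨J, hJ⟩ := exists_lt_four_pow (|d| + 1)
  refine ⟨J, fun j hj x hx => ?_⟩
  have hd : |d| < 4 ^ j - 1 := by
    have := hJ j hj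
    omega
  have hd := abs_lt.1 hd
  have h1 : (4 : ℤ) ^ (j + 1) = 4 ^ j * 4 := pow_succ 4 j
  have hpos : (0 : ℤ) < 4 ^ (j + 1) := by positivity
  have hx1 := emod_le_of_mem_markedSet j hx
  have hx2 := Int.emod_nonneg x hpos.ne'
  have hx3 := Int.emod_add_mul_ediv x (4 ^ (j + 1))
  have key (e : ℤ) (he : -4 ^ j ≤ e) (he' : e < 4 ^ j) :
      blockIndex j (x + e) = x / 4 ^ (j + 1) := by
    rw [blockIndex, ← hx3, show x % 4 ^ (j + 1) + 4 ^ (j + 1) * (x / 4 ^ (j + 1)) + e + 4 ^ j =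
      (x % 4 ^ (j + 1) + e + 4 ^ j) + 4 ^ (j + 1) * (x / 4 ^ (j + 1)) by ring,
      Int.add_mul_ediv_left _ _ hpos.ne', Int.ediv_eq_zero_of_lt (by omega) (by omega), zero_add,
      hx3]
  rw [add_assoc, key _ (by omega) (by omega), key _ (by omega) (by omega)]

section Construction

variable {G : Type*} [Group G]

/-- The left translations of `G × ℤ`. -/
def translationHom (G : Type*) [Group G] :
    G × Multiplicative ℤ →* Equiv.Perm (G × Multiplicative ℤ) :=
  MulAction.toPermHom _ _

@[simp]
theorem translationHom_apply (γ p : G × Multiplicative ℤ) : translationHom G γ p = γ * p := rfl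

theorem conj_translationHom_apply (γ p : G × Multiplicative ℤ)
    (h : Equiv.Perm (G × Multiplicative ℤ)) :
    (translationHom G γ * h * (translationHom G γ)⁻¹) p = γ * h (γ⁻¹ * p) := by
  rw [← map_inv, Equiv.Perm.mul_apply, Equiv.Perm.mul_apply, translationHom_apply,
    translationHom_apply]

open Classical in
/-- The map exchanging `(1, x)` and `(s, x + 1)` for each `x ∈ markedSet`. -/
noncomputable def markedSwapFun (s : G) (p : G × Multiplicative ℤ) : G × Multiplicative ℤ :=
  if p.1 = 1 ∧ p.2.toAdd ∈ markedSet then (s, .ofAdd (p.2.toAdd + 1))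
  else if p.1 = s ∧ p.2.toAdd - 1 ∈ markedSet then (1, .ofAdd (p.2.toAdd - 1)) else p

theorem markedSwapFun_of_mem (s : G) {x : ℤ} (hx : x ∈ markedSet) :
    markedSwapFun s (1, .ofAdd x) = (s, .ofAdd (x + 1)) := by
  simp [markedSwapFun, hx]

theorem markedSwapFun_of_mem' (s : G) {x : ℤ} (hx : x ∈ markedSet) :
    markedSwapFun s (s, .ofAdd (x + 1)) = (1, .ofAdd x) := by
  simp [markedSwapFun, hx, add_one_notMem_markedSet hx]

theorem markedSwapFun_of_notMem (s : G) {p : G × Multiplicative ℤ}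
    (h1 : ¬ (p.1 = 1 ∧ p.2.toAdd ∈ markedSet)) (h2 : ¬ (p.1 = s ∧ p.2.toAdd - 1 ∈ markedSet)) :
    markedSwapFun s p = p := by
  simp [markedSwapFun, h1, h2]

theorem markedSwapFun_cases (s : G) (p : G × Multiplicative ℤ) :
    (∃ x ∈ markedSet, p = (1, .ofAdd x) ∧ markedSwapFun s p = (s, .ofAdd (x + 1))) ∨
    (∃ x ∈ markedSet, p = (s, .ofAdd (x + 1)) ∧ markedSwapFun s p = (1, .ofAdd x)) ∨
    (¬ (p.1 = 1 ∧ p.2.toAdd ∈ markedSet) ∧ ¬ (p.1 = s ∧ p.2.toAdd - 1 ∈ markedSet) ∧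
      markedSwapFun s p = p) := by
  obtain ⟨g, m⟩ := p
  induction m using Multiplicative.rec with | _ m
  by_cases h1 : g = 1 ∧ m ∈ markedSet
  · obtain ⟨rfl, hm⟩ := h1
    exact Or.inl ⟨m, hm, rfl, markedSwapFun_of_mem s hm⟩
  · by_cases h2 : g = s ∧ m - 1 ∈ markedSet
    · obtain ⟨rfl, hm⟩ := h2
      obtain ⟨x, rfl⟩ : ∃ x, m = x + 1 := ⟨m - 1, by ring⟩
      rw [add_sub_cancel_right] at hm
      exact Or.inr (Or.inl ⟨x, hm, rfl, markedSwapFun_of_mem' g hm⟩)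
    · exact Or.inr (Or.inr ⟨h1, h2, markedSwapFun_of_notMem s h1 h2⟩)

theorem markedSwapFun_involutive (s : G) : Function.Involutive (markedSwapFun s) := by
  intro p
  rcases markedSwapFun_cases s p with ⟨x, hx, rfl, h⟩ | ⟨x, hx, rfl, h⟩ | ⟨-, -, h⟩
  · rw [h, markedSwapFun_of_mem' s hx]
  · rw [h, markedSwapFun_of_mem s hx]
  · rw [h, h]

/-- The permutation of `G × ℤ` exchanging `(1, x)` and `(s, x + 1)` for each `x ∈ markedSet`. -/
noncomputable def markedSwap (s : G) : Equiv.Perm (G × Multiplicative ℤ) :=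
  (markedSwapFun_involutive s).toPerm

@[simp]
theorem markedSwap_apply (s : G) (p : G × Multiplicative ℤ) :
    markedSwap s p = markedSwapFun s p := rfl

/-- The permutations of `G × ℤ` commuting, at each given point, with almost all the shifts by
powers of `4`. -/
def recurrentPerms (G : Type*) [Group G] : Subgroup (Equiv.Perm (G × Multiplicative ℤ)) where
  carrier := {h | ∀ p, ∀ᶠ i : ℕ in Filter.atTop,
    h (p * (1, .ofAdd (4 ^ (i + 1)))) = h p * (1, .ofAdd (4 ^ (i + 1)))}
  one_mem' _ := .of_forall fun _ => rfl
  mul_mem' {h k} hh hk p := by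
    filter_upwards [hh (k p), hk p] with i h1 h2
    rw [Equiv.Perm.mul_apply, h2, h1, Equiv.Perm.mul_apply]
  inv_mem' {h} hh p := by
    filter_upwards [hh (h⁻¹ p)] with i h1
    rw [Equiv.Perm.inv_eq_iff_eq, h1, ← Equiv.Perm.mul_apply, mul_inv_cancel, Equiv.Perm.one_apply]

theorem translationHom_mem_recurrentPerms (γ : G × Multiplicative ℤ) :
    translationHom G γ ∈ recurrentPerms G :=
  fun p => .of_forall fun _ => by simp [mul_assoc]

theorem markedSwap_mem_recurrentPerms (s : G) : markedSwap s ∈ recurrentPerms G := by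
  intro p
  filter_upwards [eventually_add_mem_markedSet_iff p.2.toAdd,
    eventually_add_mem_markedSet_iff (p.2.toAdd - 1)] with i h1 h2
  rcases markedSwapFun_cases s p with ⟨x, hx, rfl, h⟩ | ⟨x, hx, rfl, h⟩ | ⟨h3, h4, h⟩
  · rw [markedSwap_apply, markedSwap_apply, h]
    simp only [Prod.mk_mul_mk, mul_one, ← ofAdd_add]
    rw [add_right_comm]
    exact markedSwapFun_of_mem s (h1.2 hx)
  · rw [markedSwap_apply, markedSwap_apply, h]
    simp only [Prod.mk_mul_mk, mul_one, ← ofAdd_add]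
    rw [add_right_comm, markedSwapFun_of_mem' s]
    simpa [hx] using h2
  · rw [markedSwap_apply, markedSwap_apply, h]
    refine markedSwapFun_of_notMem s ?_ ?_
    · simpa [h1] using h3
    · simpa [← h2, sub_add_eq_add_sub] using h4

theorem infinite_support_of_mem_recurrentPerms {h : Equiv.Perm (G × Multiplicative ℤ)}
    (hh : h ∈ recurrentPerms G) (h1 : h ≠ 1) : {p | h p ≠ p}.Infinite := by
  obtain ⟨p, hp⟩ : ∃ p, h p ≠ p := by
    by_contra! hc
    exact h1 (Equiv.ext hc)
  obtain ⟨J, hJ⟩ := Filter.eventually_atTop.1 (hh p)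
  refine Set.infinite_of_injective_forall_mem (α := ℕ)
    (f := fun i => p * (1, .ofAdd (4 ^ (J + i + 1)))) ?_ fun i => ?_
  · intro i j hij
    have := pow_right_injective₀ (a := (4 : ℤ)) (by norm_num) (by norm_num)
      (Multiplicative.ofAdd.injective (congrArg Prod.snd (mul_left_cancel hij)))
    omega
  · rw [Set.mem_ofPred_eq, hJ _ (by omega)]
    exact fun hc => hp (mul_right_cancel hc)

/-- The permutations of `G × ℤ` that preserve all sufficiently coarse block decompositions of
every shift of `ℤ`, move finitely many fibres over `G`, and fix a neighbourhood of `-∞`. -/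
def blockPerms (G : Type*) [Group G] : Subgroup (Equiv.Perm (G × Multiplicative ℤ)) where
  carrier := {h | (∃ F : Set G, F.Finite ∧ ∀ p, p.1 ∉ F → h p = p) ∧
    (∃ n : ℤ, ∀ p, p.2.toAdd ≤ n → h p = p) ∧
    ∀ d : ℤ, ∃ J : ℕ, ∀ j ≥ J, ∀ p,
      blockIndex j ((h p).2.toAdd + d) = blockIndex j (p.2.toAdd + d)}
  one_mem' := ⟨⟨∅, Set.finite_empty, fun _ _ => rfl⟩, ⟨0, fun _ _ => rfl⟩,
    fun _ => ⟨0, fun _ _ _ => rfl⟩⟩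
  mul_mem' {h k} := by
    rintro ⟨⟨F, hF, h1⟩, ⟨n, h2⟩, h3⟩ ⟨⟨E, hE, k1⟩, ⟨m, k2⟩, k3⟩
    refine ⟨⟨F ∪ E, hF.union hE, fun p hp => ?_⟩, ⟨min n m, fun p hp => ?_⟩, fun d => ?_⟩
    · rw [Set.mem_union, not_or] at hp
      rw [Equiv.Perm.mul_apply, k1 p hp.2, h1 p hp.1]
    · rw [Equiv.Perm.mul_apply, k2 p (hp.trans (min_le_right _ _)),
        h2 p (hp.trans (min_le_left _ _))]
    · obtain ⟨J, hJ⟩ := h3 d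
      obtain ⟨L, hL⟩ := k3 d
      refine ⟨max J L, fun j hj p => ?_⟩
      rw [Equiv.Perm.mul_apply, hJ j ((le_max_left _ _).trans hj),
        hL j ((le_max_right _ _).trans hj)]
  inv_mem' {h} := by
    rintro ⟨⟨F, hF, h1⟩, ⟨n, h2⟩, h3⟩
    refine ⟨⟨F, hF, fun p hp => ?_⟩, ⟨n, fun p hp => ?_⟩, fun d => ?_⟩
    · rw [Equiv.Perm.inv_eq_iff_eq, h1 p hp]
    · rw [Equiv.Perm.inv_eq_iff_eq, h2 p hp]
    · obtain ⟨J, hJ⟩ := h3 d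
      refine ⟨J, fun j hj p => ?_⟩
      rw [← hJ j hj, ← Equiv.Perm.mul_apply, mul_inv_cancel, Equiv.Perm.one_apply]

theorem markedSwap_mem_blockPerms (s : G) : markedSwap s ∈ blockPerms G := by
  refine ⟨⟨{1, s}, by simp, fun p hp => ?_⟩, ⟨-1, fun p hp => ?_⟩, fun d => ?_⟩
  · rw [Set.mem_insert_iff, Set.mem_singleton_iff, not_or] at hp
    exact markedSwapFun_of_notMem s (fun h => hp.1 h.1) (fun h => hp.2 h.1)
  · refine markedSwapFun_of_notMem s (fun h => ?_) (fun h => ?_)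
    · have := nonneg_of_mem_markedSet h.2
      omega
    · have := nonneg_of_mem_markedSet h.2
      omega
  · obtain ⟨J, hJ⟩ := exists_blockIndex_add_one_eq d
    refine ⟨J, fun j hj p => ?_⟩
    rcases markedSwapFun_cases s p with ⟨x, hx, rfl, h⟩ | ⟨x, hx, rfl, h⟩ | ⟨-, -, h⟩
    · rw [markedSwap_apply, h]
      exact hJ j hj x hx
    · rw [markedSwap_apply, h]
      exact (hJ j hj x hx).symm
    · rw [markedSwap_apply, h]

theorem conj_mem_blockPerms (γ : G × Multiplicative ℤ) {h : Equiv.Perm (G × Multiplicative ℤ)}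
    (hh : h ∈ blockPerms G) :
    translationHom G γ * h * (translationHom G γ)⁻¹ ∈ blockPerms G := by
  obtain ⟨⟨F, hF, h1⟩, ⟨n, h2⟩, h3⟩ := hh
  have hfix {p : G × Multiplicative ℤ} (hp : h (γ⁻¹ * p) = γ⁻¹ * p) :
      (translationHom G γ * h * (translationHom G γ)⁻¹) p = p := by
    rw [conj_translationHom_apply, hp, mul_inv_cancel_left]
  refine ⟨⟨(γ.1 * ·) '' F, hF.image _, fun p hp => hfix (h1 _ fun hc => hp ?_)⟩,
    ⟨n + γ.2.toAdd, fun p hp => hfix (h2 _ ?_)⟩, fun d => ?_⟩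
  · exact ⟨_, hc, by simp⟩
  · simp only [Prod.snd_mul, Prod.snd_inv, toAdd_mul, toAdd_inv]
    omega
  · obtain ⟨J, hJ⟩ := h3 (γ.2.toAdd + d)
    refine ⟨J, fun j hj p => ?_⟩
    have := hJ j hj (γ⁻¹ * p)
    rw [conj_translationHom_apply]
    simp only [Prod.snd_mul, Prod.snd_inv, toAdd_mul, toAdd_inv] at this ⊢
    convert this using 2 <;> ring

theorem eq_one_of_translationHom_mem_blockPerms {γ : G × Multiplicative ℤ}
    (h : translationHom G γ ∈ blockPerms G) : γ = 1 := by
  obtain ⟨-, ⟨n, hn⟩, -⟩ := h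
  simpa using hn (1, .ofAdd n) le_rfl

/-- The group `blockPerms G` is locally finite. -/
theorem finite_of_fg_of_le_blockPerms {K : Subgroup (Equiv.Perm (G × Multiplicative ℤ))}
    (hK : K.FG) (hle : K ≤ blockPerms G) : Finite K := by
  classical
  obtain ⟨S, rfl⟩ := id hK
  have hS (h : S) : (h : Equiv.Perm (G × Multiplicative ℤ)) ∈ blockPerms G :=
    hle (Subgroup.mem_closure_of_mem h.2)
  choose F hF hfix using fun h => (hS h).1
  choose J hJ using fun h => (hS h).2.2 0
  let E : Set G := ⋃ h, F h
  have hE : E.Finite := Set.finite_iUnion hF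
  let j : ℕ := Finset.univ.sup J
  have key (h) (hh : h ∈ Subgroup.closure (S : Set (Equiv.Perm (G × Multiplicative ℤ)))) :
      ∀ p, (p.1 ∉ E → h p = p) ∧ blockIndex j (h p).2.toAdd = blockIndex j p.2.toAdd := by
    induction hh using Subgroup.closure_induction with
    | mem h hh =>
      refine fun p => ⟨fun hp => hfix ⟨h, hh⟩ p fun hc => hp (Set.mem_iUnion.2 ⟨_, hc⟩), ?_⟩
      simpa using hJ ⟨h, hh⟩ j (Finset.le_sup (Finset.mem_univ _)) p
    | one => exact fun p => ⟨fun _ => rfl, rfl⟩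
    | mul h k _ _ hh hk =>
      refine fun p => ⟨fun hp => ?_, ?_⟩
      · rw [Equiv.Perm.mul_apply, (hk p).1 hp, (hh p).1 hp]
      · rw [Equiv.Perm.mul_apply, (hh _).2, (hk p).2]
    | inv h _ hh =>
      refine fun p => ⟨fun hp => ?_, ?_⟩
      · rw [Equiv.Perm.inv_eq_iff_eq, (hh p).1 hp]
      · rw [← (hh _).2, ← Equiv.Perm.mul_apply, mul_inv_cancel, Equiv.Perm.one_apply]
  have : Finite E := hE
  let κ (p : G × Multiplicative ℤ) : Option E × ZMod (4 ^ (j + 1)) :=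
    (if hp : p.1 ∈ E then some ⟨p.1, hp⟩ else none, ((p.2.toAdd + 4 ^ j : ℤ) : ZMod (4 ^ (j + 1))))
  refine finite_of_fg_of_orbit_separating _ hK κ fun h hh p hp => ?_
  by_cases hpE : p.1 ∈ E
  · have h1 := congrArg Prod.fst hp
    have h2 := congrArg Prod.snd hp
    refine Prod.ext ?_ (Multiplicative.toAdd.injective ?_)
    · by_cases hqE : (h p).1 ∈ E
      · simpa [κ, hpE, hqE] using h1
      · simp [κ, hpE, hqE] at h1
    · have h3 := (ZMod.intCast_eq_intCast_iff' _ _ _).1 h2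
      push_cast at h3
      have h4 := (key h hh p).2
      rw [blockIndex, blockIndex] at h4
      have h5 := Int.emod_add_mul_ediv ((h p).2.toAdd + 4 ^ j) (4 ^ (j + 1))
      rw [h3, h4, Int.emod_add_mul_ediv] at h5
      omega
  · exact (key h hh p).1 hpE

/-- Near any finite set, a conjugate of `markedSwap s` looks like a transposition. -/
theorem swap_mul_mem_pointwiseClosure [DecidableEq (G × Multiplicative ℤ)]
    {H : Subgroup (Equiv.Perm (G × Multiplicative ℤ))}
    (hH : ∀ γ, translationHom G γ ∈ H) {s : G} (hs : markedSwap s ∈ H) (q : G × Multiplicative ℤ) :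
    Equiv.swap q (q * (s, .ofAdd 1)) ∈ pointwiseClosure H := by
  intro A hA
  obtain ⟨n, hn⟩ : ∃ n : ℤ, ∀ a ∈ A, |a.2.toAdd - q.2.toAdd| ≤ n :=
    (hA.image fun a => |a.2.toAdd - q.2.toAdd|).bddAbove.imp fun n hn a ha => hn ⟨a, ha, rfl⟩
  obtain ⟨x, hx, hxn⟩ := exists_isolated_mem_markedSet (n + 1)
  let γ : G × Multiplicative ℤ := q * (1, .ofAdd (-x))
  refine ⟨translationHom G γ * markedSwap s * (translationHom G γ)⁻¹,
    H.mul_mem (H.mul_mem (hH _) hs) (H.inv_mem (hH _)), fun a ha => ?_⟩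
  have hγ : γ * (1, .ofAdd x) = q := by simp [γ, mul_assoc]
  have hγ' : γ * (s, .ofAdd (x + 1)) = q * (s, .ofAdd 1) := by
    simp [γ, mul_assoc, ofAdd_add]
  obtain ⟨b, rfl⟩ : ∃ b, a = γ * b := ⟨γ⁻¹ * a, by simp⟩
  have hb : |b.2.toAdd - x| ≤ n := by
    have := hn _ ha
    simp only [γ, Prod.snd_mul, toAdd_mul, toAdd_ofAdd] at this
    convert this using 2
    ring
  have hb' := abs_le.1 hb
  rw [conj_translationHom_apply, inv_mul_cancel_left, ← hγ', ← hγ, markedSwap_apply]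
  rcases markedSwapFun_cases s b with ⟨y, hy, rfl, h⟩ | ⟨y, hy, rfl, h⟩ | ⟨h1, h2, h⟩
  · obtain rfl : y = x := hxn y hy (hb.trans (by omega))
    rw [h, Equiv.swap_apply_left]
  · obtain rfl : y = x := hxn y hy (abs_le.2 (by simp at hb'; omega))
    rw [h, Equiv.swap_apply_right]
  · rw [h, Equiv.swap_apply_of_ne_of_ne]
    · intro hc
      obtain rfl := mul_left_cancel hc
      exact h1 ⟨rfl, hx⟩
    · intro hc
      obtain rfl := mul_left_cancel hc
      exact h2 ⟨rfl, by simpa using hx⟩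

theorem swap_mem_pointwiseClosure [DecidableEq (G × Multiplicative ℤ)] {S : Set G}
    (hS : Subgroup.closure S = ⊤) {H : Subgroup (Equiv.Perm (G × Multiplicative ℤ))}
    (hH : ∀ γ, translationHom G γ ∈ H) (hs : ∀ s ∈ insert 1 S, markedSwap s ∈ H)
    (p q : G × Multiplicative ℤ) : Equiv.swap p q ∈ pointwiseClosure H := by
  have htrans (a b c : G × Multiplicative ℤ) (hab : Equiv.swap a b ∈ pointwiseClosure H)
      (hbc : Equiv.swap b c ∈ pointwiseClosure H) : Equiv.swap a c ∈ pointwiseClosure H := by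
    by_cases h1 : a = b
    · rwa [h1]
    by_cases h2 : a = c
    · rw [h2, Equiv.swap_self]
      exact Subgroup.one_mem _
    rw [Equiv.swap_comm, ← Equiv.swap_mul_swap_mul_swap h1 h2]
    exact Subgroup.mul_mem _ (Subgroup.mul_mem _ hbc hab) hbc
  let C : Subgroup (G × Multiplicative ℤ) :=
    { carrier := {γ | ∀ q, Equiv.swap q (q * γ) ∈ pointwiseClosure H}
      one_mem' := fun q => by
        rw [mul_one, Equiv.swap_self]
        exact Subgroup.one_mem _
      mul_mem' := fun {a b} ha hb q => htrans _ _ _ (ha q) (by simpa [mul_assoc] using hb (q * a))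
      inv_mem' := fun {a} ha q => by simpa [Equiv.swap_comm] using ha (q * a⁻¹) }
  have hC (s : G) (h : s ∈ insert 1 S) : (s, .ofAdd 1) ∈ C :=
    fun q => swap_mul_mem_pointwiseClosure hH (hs s h) q
  have h1 : ((1 : G), Multiplicative.ofAdd (1 : ℤ)) ∈ C := hC 1 (Set.mem_insert _ _)
  have h2 : C.comap (MonoidHom.inl G (Multiplicative ℤ)) = ⊤ := by
    rw [eq_top_iff, ← hS, Subgroup.closure_le]
    intro s h
    simpa using C.mul_mem (hC s (Set.mem_insert_of_mem _ h)) (C.inv_mem h1)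
  have h3 (γ : G × Multiplicative ℤ) : γ ∈ C := by
    have h4 : (γ.1, 1) ∈ C := by
      have : γ.1 ∈ C.comap (MonoidHom.inl G (Multiplicative ℤ)) := h2 ▸ Subgroup.mem_top _
      exact this
    have h5 := C.mul_mem h4 (C.zpow_mem h1 γ.2.toAdd)
    convert h5 using 1
    refine Prod.ext (by simp) ?_
    simp [← ofAdd_zsmul]
  simpa using h3 (p⁻¹ * q) p

/-- The group generated by the translations of `G × ℤ` by `S` and `ℤ`, and by the permutations
`markedSwap s` for `s ∈ S ∪ {1}`. -/
def markedGroup (S : Set G) : Subgroup (Equiv.Perm (G × Multiplicative ℤ)) :=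
  Subgroup.closure ((fun s => translationHom G (s, 1)) '' S ∪ {translationHom G (1, .ofAdd 1)} ∪
    markedSwap '' insert 1 S)

theorem markedGroup_fg {S : Set G} (hS : S.Finite) : (markedGroup S).FG :=
  (Subgroup.fg_iff _).2 ⟨_, rfl,
    ((hS.image _).union (Set.finite_singleton _)).union ((hS.insert 1).image _)⟩

theorem markedSwap_mem_markedGroup {S : Set G} {s : G} (hs : s ∈ insert 1 S) :
    markedSwap s ∈ markedGroup S :=
  Subgroup.mem_closure_of_mem (Or.inr ⟨s, hs, rfl⟩)

theorem translationHom_mem_markedGroup {S : Set G} (hS : Subgroup.closure S = ⊤)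
    (γ : G × Multiplicative ℤ) : translationHom G γ ∈ markedGroup S := by
  let C := (markedGroup S).comap (translationHom G)
  have h1 : ((1 : G), Multiplicative.ofAdd (1 : ℤ)) ∈ C :=
    Subgroup.mem_closure_of_mem (Or.inl (Or.inr rfl))
  have h2 : C.comap (MonoidHom.inl G (Multiplicative ℤ)) = ⊤ := by
    rw [eq_top_iff, ← hS, Subgroup.closure_le]
    exact fun s hs => Subgroup.mem_closure_of_mem (Or.inl (Or.inl ⟨s, hs, rfl⟩))
  have h4 : (γ.1, 1) ∈ C := by
    have : γ.1 ∈ C.comap (MonoidHom.inl G (Multiplicative ℤ)) := h2 ▸ Subgroup.mem_top _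
    exact this
  have h5 := C.mul_mem h4 (C.zpow_mem h1 γ.2.toAdd)
  have h6 : γ = (γ.1, 1) * (1, .ofAdd 1) ^ γ.2.toAdd :=
    Prod.ext (by simp) (by simp [← ofAdd_zsmul])
  rw [h6]
  exact h5

theorem markedGroup_le_recurrentPerms (S : Set G) : markedGroup S ≤ recurrentPerms G := by
  refine (Subgroup.closure_le _).2 ?_
  rintro _ ((⟨s, -, rfl⟩ | rfl) | ⟨s, -, rfl⟩)
  · exact translationHom_mem_recurrentPerms _
  · exact translationHom_mem_recurrentPerms _
  · exact markedSwap_mem_recurrentPerms s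

/-- The permutations of the form `n * γ` with `n ∈ blockPerms G` and `γ` a translation, together
with `γ`. -/
def translationPairs (G : Type*) [Group G] :
    Subgroup (Equiv.Perm (G × Multiplicative ℤ) × (G × Multiplicative ℤ)) where
  carrier := {a | a.1 * (translationHom G a.2)⁻¹ ∈ blockPerms G}
  one_mem' := by simp
  mul_mem' {a b} ha hb := by
    have := Subgroup.mul_mem _ ha (conj_mem_blockPerms a.2 hb)
    simpa [mul_assoc] using this
  inv_mem' {a} ha := by
    have := conj_mem_blockPerms a.2⁻¹ (Subgroup.inv_mem _ ha)
    simpa [mul_assoc] using this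

theorem eq_of_mem_translationPairs {h : Equiv.Perm (G × Multiplicative ℤ)}
    {γ δ : G × Multiplicative ℤ} (hγ : (h, γ) ∈ translationPairs G)
    (hδ : (h, δ) ∈ translationPairs G) : γ = δ := by
  have h1 : (1, γ⁻¹ * δ) ∈ translationPairs G := by
    simpa using (translationPairs G).mul_mem ((translationPairs G).inv_mem hγ) hδ
  have h2 : 1 * (translationHom G (γ⁻¹ * δ))⁻¹ ∈ blockPerms G := h1
  rw [one_mul] at h2
  exact inv_mul_eq_one.1 (eq_one_of_translationHom_mem_blockPerms (inv_mem_iff.1 h2))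

theorem translationHom_mem_translationPairs (γ : G × Multiplicative ℤ) :
    (translationHom G γ, γ) ∈ translationPairs G := by
  change _ * _ ∈ blockPerms G
  rw [mul_inv_cancel]
  exact Subgroup.one_mem _

theorem exists_mem_translationPairs {S : Set G} {h : Equiv.Perm (G × Multiplicative ℤ)}
    (hh : h ∈ markedGroup S) : ∃ γ, (h, γ) ∈ translationPairs G := by
  have hle : markedGroup S ≤ (translationPairs G).map (MonoidHom.fst _ _) := by
    refine (Subgroup.closure_le _).2 ?_
    rintro _ ((⟨s, -, rfl⟩ | rfl) | ⟨s, -, rfl⟩)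
    · exact ⟨_, translationHom_mem_translationPairs _, rfl⟩
    · exact ⟨_, translationHom_mem_translationPairs _, rfl⟩
    · refine ⟨(markedSwap s, 1), ?_, rfl⟩
      change _ * _ ∈ blockPerms G
      rw [map_one, inv_one, mul_one]
      exact markedSwap_mem_blockPerms s
  obtain ⟨⟨_, γ⟩, hγ, rfl⟩ := hle hh
  exact ⟨γ, hγ⟩

theorem exists_hom_of_markedGroup {S : Set G} (hS : Subgroup.closure S = ⊤) :
    ∃ φ : markedGroup S →* G × Multiplicative ℤ,
      Function.Surjective φ ∧ IsLocallyFinite φ.ker := by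
  choose f hf using fun h : markedGroup S => exists_mem_translationPairs h.2
  let φ : markedGroup S →* G × Multiplicative ℤ := MonoidHom.mk' f fun a b =>
    eq_of_mem_translationPairs (hf (a * b)) ((translationPairs G).mul_mem (hf a) (hf b))
  refine ⟨φ, fun γ => ⟨⟨_, translationHom_mem_markedGroup hS γ⟩,
    eq_of_mem_translationPairs (hf _) (translationHom_mem_translationPairs γ)⟩, fun K hK => ?_⟩
  let ι : φ.ker →* Equiv.Perm (G × Multiplicative ℤ) :=
    (markedGroup S).subtype.comp φ.ker.subtype
  have hι : Function.Injective ι := Subtype.val_injective.comp Subtype.val_injective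
  have hfin : Finite (K.map ι) := by
    refine finite_of_fg_of_le_blockPerms ?_ ?_
    · classical
      obtain ⟨T, rfl⟩ := hK
      exact ⟨T.image ι, by rw [Finset.coe_image, ← MonoidHom.map_closure]⟩
    rintro _ ⟨k, -, rfl⟩
    have h1 : _ * _ ∈ blockPerms G := hf k
    have h2 : f k = 1 := k.2
    rw [h2, map_one, inv_one, mul_one] at h1
    exact h1
  exact (K.equivMapOfInjective ι hι).finite_iff.2 hfin

end Construction

/-- For every finitely generated group `G` there is a finitely generated group `H` with
`G ≤ H ≤ Sym(G × ℤ)` (where `G × ℤ` sits in `Sym(G × ℤ)` via left translations and `G` is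
the first factor) such that: (1) `H` has a locally finite normal subgroup (a kernel) with
quotient isomorphic to `G × ℤ`; (2) the natural action of `H` on `G × ℤ` is faithful and
`k`-transitive for every `k`; (3) `H` is mixed identity free. -/
theorem statement0 (G : Type) [Group G] [Group.FG G] :
    ∃ H : Subgroup (Equiv.Perm (G × Multiplicative ℤ)),
      H.FG ∧
      (∀ g : G,
        MulAction.toPermHom (G × Multiplicative ℤ) (G × Multiplicative ℤ) (g, 1) ∈ H) ∧
      (∃ φ : H →* G × Multiplicative ℤ,
        Function.Surjective φ ∧ IsLocallyFinite φ.ker) ∧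
      Function.Injective H.subtype ∧
      (∀ k : ℕ, IsKTransitive H.subtype k) ∧
      MixedIdentityFree H := by
  classical
  obtain ⟨S, hS⟩ := Group.fg_def.1 ‹Group.FG G›
  have hswap := swap_mem_pointwiseClosure hS (translationHom_mem_markedGroup hS)
    fun s hs => markedSwap_mem_markedGroup hs
  refine ⟨markedGroup (S : Set G), markedGroup_fg S.finite_toSet,
    fun g => translationHom_mem_markedGroup hS _, exists_hom_of_markedGroup hS,
    Subgroup.subtype_injective _, isKTransitive_of_swap_mem _ hswap,
    mixedIdentityFree_of_infinite_support hswap fun h h1 => ?_⟩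
  exact infinite_support_of_mem_recurrentPerms (markedGroup_le_recurrentPerms _ h.2)
    fun hc => h1 (Subtype.ext hc)
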